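/- Suppose N₂ = 3 and p ≡ 2 (mod 3). Then k = sm is even and C(r,N) is a two-weight code with weight distribution 1 + ((r-1)/3)x^{(q-1)(r + (-1)^{k/2}·2√r)/(Nq)} + (2(r-1)/3)x^{(q-1)(r - (-1)^{k/2}√r)/(Nq)}, i.e. (r-1)/3 codewords of weight (q-1)(r + (-1)^{k/2}2√r)/(Nq) and 2(r-1)/3 codewords of weight (q-1)(r - (-1)^{k/2}√r)/(Nq). -/

import Mathlib

open scoped Classical

/-- The Hamming weight of the codeword `c(β) = (Tr_{r/q}(βθʲ))_{j=0}^{n-1}`. -/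
noncomputable def codewordWeight (K F : Type) [Field K] [Field F] [Algebra K F]
    (θ : F) (n : ℕ) (β : F) : ℕ :=
  (Finset.univ.filter fun j : Fin n => Algebra.trace K F (β * θ ^ (j : ℕ)) ≠ 0).card

theorem FiniteField.exists_algebraMap_eq_of_pow_card_eq (K : Type*) {F : Type*} [Field K]
    [Fintype K] [Field F] [Algebra K F] {y : F} (hy : y ^ Fintype.card K = y) :
    ∃ a : K, algebraMap K F a = y := by
  have h1 : 1 < Fintype.card K := Fintype.one_lt_card
  have h0 := FiniteField.X_pow_card_sub_X_ne_zero F h1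
  have hsub : Finset.univ.image (algebraMap K F) ⊆
      (Polynomial.X ^ Fintype.card K - Polynomial.X : Polynomial F).roots.toFinset := by
    intro x hx
    obtain ⟨a, -, rfl⟩ := Finset.mem_image.1 hx
    simp [h0, ← map_pow, FiniteField.pow_card, Polynomial.IsRoot]
  have heq := Finset.eq_of_subset_of_card_le hsub (by
    rw [Finset.card_image_of_injective _ (algebraMap K F).injective, Finset.card_univ]
    refine (Multiset.toFinset_card_le _).trans ((Polynomial.card_roots' _).trans ?_)
    rw [FiniteField.X_pow_card_sub_X_natDegree_eq F h1])
  have hmem : y ∈ Finset.univ.image (algebraMap K F) := by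
    rw [heq]
    simp [h0, Polynomial.IsRoot, hy]
  obtain ⟨a, -, ha⟩ := Finset.mem_image.1 hmem
  exact ⟨a, ha⟩

theorem FiniteField.exists_units_pow_eq_algebraMap {K F : Type*} [Field K] [Fintype K]
    [Field F] [Fintype F] [Algebra K F] {d : ℕ}
    (hd : d ∣ (Fintype.card F - 1) / (Fintype.card K - 1)) {a : K} (ha : a ≠ 0) :
    ∃ u : Fˣ, (u : F) ^ d = algebraMap K F a := by
  have h1 : 1 < Fintype.card K := Fintype.one_lt_card
  have hdvd : Fintype.card K - 1 ∣ Fintype.card F - 1 := by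
    rw [Module.card_eq_pow_finrank (K := K) (V := F)]
    simpa using Nat.sub_dvd_pow_sub_pow (Fintype.card K) 1 (Module.finrank K F)
  obtain ⟨g, hg⟩ := IsCyclic.exists_generator (α := Fˣ)
  set b : Fˣ := Units.map (algebraMap K F).toMonoidHom (Units.mk0 a ha) with hb
  have hb1 : b ^ (Fintype.card K - 1) = 1 := by
    ext
    simp [hb, ← map_pow, FiniteField.pow_card_sub_one_eq_one a ha]
  obtain ⟨i, hi⟩ : ∃ i : ℕ, g ^ i = b := by
    have := mem_powers_iff_mem_zpowers.2 (hg b)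
    exact this
  have hord : orderOf g = Fintype.card F - 1 := by
    rw [orderOf_eq_card_of_forall_mem_zpowers hg, Nat.card_eq_fintype_card, Fintype.card_units]
  rw [← hi, ← pow_mul, ← orderOf_dvd_iff_pow_eq_one, hord] at hb1
  obtain ⟨e, he⟩ := hdvd
  rw [he, Nat.mul_div_cancel_left _ (by omega)] at hd
  rw [he, mul_comm] at hb1
  obtain ⟨j, rfl⟩ := hd.trans (Nat.dvd_of_mul_dvd_mul_right (by omega) hb1)
  refine ⟨g ^ j, ?_⟩
  rw [← Units.val_pow_eq_pow_val, ← pow_mul, mul_comm, hi]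
  simp [hb]

theorem Nat.exists_coprime_modEq_gcd_mul {N M R : ℕ} (hR : R ≠ 0) (hM : M ∣ R) :
    ∃ u, R.Coprime u ∧ N ≡ Nat.gcd N M * u [MOD M] := by
  have : NeZero R := ⟨hR⟩
  obtain ⟨d, hd, u, hu, h⟩ := ZMod.eq_unit_mul_divisor (N := M) (N : ZMod M)
  obtain ⟨v, hv⟩ := ZMod.unitsMap_surjective hM hu.unit
  have hvu : ((v : ZMod R).val : ZMod M) = u := by
    have := congrArg Units.val hv
    rw [ZMod.unitsMap_val] at this
    rw [ZMod.natCast_val]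
    exact this
  have hcop : (v : ZMod R).val.Coprime R := ZMod.val_coe_unit_coprime v
  have hmod : N ≡ d * (v : ZMod R).val [MOD M] := by
    rw [← ZMod.natCast_eq_natCast_iff]
    push_cast
    rw [hvu, h, mul_comm]
  have hgcd : Nat.gcd N M = d := by
    rw [hmod.gcd_eq, Nat.Coprime.gcd_mul_right_cancel d (hcop.coprime_dvd_right hM),
      Nat.gcd_eq_left hd]
  exact ⟨_, hcop.symm, hgcd ▸ hmod⟩

theorem FiniteField.sum_pow_eq_sum_pow_gcd {K F A : Type*} [Field K] [Fintype K]
    [Field F] [Fintype F] [Algebra K F] [AddCommMonoid A] (N : ℕ) (g : F → A)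
    (hg : ∀ (a : K) (x : F), a ≠ 0 → g (algebraMap K F a * x) = g x) :
    ∑ x : Fˣ, g ((x : F) ^ N) =
      ∑ x : Fˣ, g ((x : F) ^ Nat.gcd N ((Fintype.card F - 1) / (Fintype.card K - 1))) := by
  have h1 : 1 < Fintype.card K := Fintype.one_lt_card
  have h1' : 1 < Fintype.card F := Fintype.one_lt_card
  have hdvd : Fintype.card K - 1 ∣ Fintype.card F - 1 := by
    rw [Module.card_eq_pow_finrank (K := K) (V := F)]
    simpa using Nat.sub_dvd_pow_sub_pow (Fintype.card K) 1 (Module.finrank K F)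
  have hMdvd := Nat.div_dvd_of_dvd hdvd
  set M := (Fintype.card F - 1) / (Fintype.card K - 1) with hM
  have hMq : M * (Fintype.card K - 1) = Fintype.card F - 1 := Nat.div_mul_cancel hdvd
  obtain ⟨u, hu, hmod⟩ := Nat.exists_coprime_modEq_gcd_mul (N := N)
    (show Fintype.card F - 1 ≠ 0 by omega) hMdvd
  have hu' : (Nat.card Fˣ).Coprime u := by
    rwa [Nat.card_eq_fintype_card, Fintype.card_units]
  rw [← Equiv.sum_comp (powCoprime hu') (fun x : Fˣ => g ((x : F) ^ Nat.gcd N M))]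
  refine Finset.sum_congr rfl fun x _ => ?_
  have hmod' := hmod.mul_right' (Fintype.card K - 1)
  rw [hMq] at hmod'
  have hx : (x : F) ≠ 0 := x.ne_zero
  have hone : (x : F) ^ (Fintype.card F - 1) = 1 := FiniteField.pow_card_sub_one_eq_one _ hx
  have hpow : (x : F) ^ (N * (Fintype.card K - 1)) =
      (x : F) ^ (Nat.gcd N M * u * (Fintype.card K - 1)) := by
    rw [← Nat.div_add_mod (N * (Fintype.card K - 1)) (Fintype.card F - 1), hmod',
      pow_add, pow_mul, hone, one_pow, one_mul]
    conv_rhs => rw [← Nat.div_add_mod (Nat.gcd N M * u * (Fintype.card K - 1))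
      (Fintype.card F - 1), pow_add, pow_mul, hone, one_pow, one_mul]
  have hv : ((x : F) ^ N / (x : F) ^ (Nat.gcd N M * u)) ^ (Fintype.card K - 1) = 1 := by
    rw [div_pow, ← pow_mul, ← pow_mul, hpow, div_self (pow_ne_zero _ hx)]
  obtain ⟨a, ha⟩ := FiniteField.exists_algebraMap_eq_of_pow_card_eq K
    (y := (x : F) ^ N / (x : F) ^ (Nat.gcd N M * u)) (by
      conv_lhs => rw [← Nat.sub_add_cancel h1.le, pow_succ, hv, one_mul])
  have ha0 : a ≠ 0 := by
    rintro rfl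
    rw [map_zero] at ha
    exact div_ne_zero (pow_ne_zero _ hx) (pow_ne_zero _ hx) ha.symm
  rw [powCoprime_apply, Units.val_pow_eq_pow_val, ← pow_mul, mul_comm u, ← hg a ((x : F) ^ (Nat.gcd N M * u)) ha0, ha,
    div_mul_cancel₀ _ (pow_ne_zero _ hx)]
theorem Finset.sum_range_mul_of_periodic {M : Type*} [AddCommMonoid M] (f : ℕ → M) (d e : ℕ)
    (hf : ∀ i, f (i + d) = f i) :
    ∑ i ∈ Finset.range (e * d), f i = e • ∑ i ∈ Finset.range d, f i := by
  have hf' : Function.Periodic f d := hf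
  induction e with
  | zero => simp
  | succ e ih =>
    rw [add_mul, one_mul, Finset.sum_range_add, ih, succ_nsmul]
    congr 1
    refine Finset.sum_congr rfl fun i _ => ?_
    rw [add_comm]
    exact_mod_cast hf'.nat_mul e i

theorem sum_eq_nsmul_sum_range_of_generator {G M : Type*} [Group G] [Fintype G] [AddCommMonoid M]
    {g : G} (hg : ∀ x, x ∈ Subgroup.zpowers g) (h : G → M) {d e : ℕ}
    (hde : e * d = Fintype.card G) (hh : ∀ i : ℕ, h (g ^ (i + d)) = h (g ^ i)) :
    ∑ x, h x = e • ∑ i ∈ Finset.range d, h (g ^ i) := by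
  classical
  rw [← Finset.sum_range_mul_of_periodic (fun i => h (g ^ i)) d e hh, hde,
    ← IsCyclic.image_range_card (α := G) hg, Nat.card_eq_fintype_card, Finset.sum_image]
  · intro i hi j hj hij
    rw [← Nat.card_eq_fintype_card, ← orderOf_eq_card_of_forall_mem_zpowers hg,
      Finset.coe_range] at hi hj
    exact pow_injOn_Iio_orderOf hi hj hij

theorem Int.prime_dvd_of_dvd_sq_add_mul_add_sq {p : ℕ} (hp : p.Prime) (hp3 : p % 3 = 2) {a b : ℤ}
    (h : (p : ℤ) ∣ a ^ 2 + a * b + b ^ 2) : (p : ℤ) ∣ a ∧ (p : ℤ) ∣ b := by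
  have := Fact.mk hp
  have key : ∀ x y : ℤ, (p : ℤ) ∣ x ^ 2 + x * y + y ^ 2 → (p : ℤ) ∣ y := by
    intro x y hxy
    rw [← ZMod.intCast_zmod_eq_zero_iff_dvd] at hxy ⊢
    by_contra hy
    push_cast at hxy
    set u : ZMod p := x / y with hu
    have hu2 : u ^ 2 + u + 1 = 0 := by
      rw [hu]; field_simp; linear_combination hxy
    have hu3 : u ^ 3 = 1 := by linear_combination (u - 1) * hu2
    have h3 : (3 : ZMod p) ≠ 0 := by
      intro h0
      have : ((3 : ℕ) : ZMod p) = 0 := by exact_mod_cast h0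
      rw [ZMod.natCast_eq_zero_iff] at this
      have := (Nat.prime_dvd_prime_iff_eq hp Nat.prime_three).1 this
      omega
    have hu1 : u ≠ 1 := by
      intro h1
      rw [h1] at hu2
      exact h3 (by linear_combination hu2)
    have : Fact (Nat.Prime 3) := ⟨Nat.prime_three⟩
    have ho : orderOf u = 3 := orderOf_eq_prime hu3 hu1
    have hu0 : u ≠ 0 := by rintro h0; rw [h0] at hu3; simp at hu3
    have := orderOf_dvd_of_pow_eq_one (ZMod.pow_card_sub_one_eq_one hu0)
    rw [ho] at this
    have := hp.two_le
    omega
  exact ⟨key b a (by convert h using 1; ring), key a b h⟩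

theorem sq_add_mul_add_sq_eq_three_mul_pow {p : ℕ} (hp : p.Prime) (hp3 : p % 3 = 2) (k : ℕ)
    (a b : ℤ) (h : a ^ 2 + a * b + b ^ 2 = 3 * (p : ℤ) ^ k) :
    2 ∣ k ∧ ∃ a' b' : ℤ, a = (p : ℤ) ^ (k / 2) * a' ∧ b = (p : ℤ) ^ (k / 2) * b' ∧
      a' ^ 2 + a' * b' + b' ^ 2 = 3 := by
  have hp0 : (p : ℤ) ≠ 0 := by exact_mod_cast hp.ne_zero
  induction k using Nat.strong_induction_on generalizing a b with
  | _ k ih =>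
    rcases Nat.eq_zero_or_pos k with rfl | hk
    · exact ⟨dvd_zero _, a, b, by simp, by simp, by simpa using h⟩
    obtain ⟨⟨c, rfl⟩, ⟨d, rfl⟩⟩ := Int.prime_dvd_of_dvd_sq_add_mul_add_sq hp hp3
      (a := a) (b := b) (h ▸ Dvd.dvd.mul_left (dvd_pow_self _ hk.ne') 3)
    obtain rfl | ⟨l, rfl⟩ : k = 1 ∨ ∃ l, k = l + 2 := by
      rcases k with _ | _ | l
      · omega
      · simp
      · exact Or.inr ⟨l, rfl⟩
    · exfalso
      have h3 : (3 : ℤ) = p * (c ^ 2 + c * d + d ^ 2) :=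
        mul_left_cancel₀ hp0 (by linear_combination -h)
      have : (p : ℤ) ∣ (3 : ℕ) := ⟨_, by exact_mod_cast h3⟩
      have := (Nat.prime_dvd_prime_iff_eq hp Nat.prime_three).1 (by exact_mod_cast this)
      omega
    · obtain ⟨⟨e, rfl⟩, a', b', rfl, rfl, h'⟩ := ih l (by omega) c d
        (mul_left_cancel₀ (pow_ne_zero 2 hp0) (by linear_combination h))
      have : (2 * e + 2) / 2 = e + 1 := by omega
      have h2 : (2 * e) / 2 = e := by omega
      refine ⟨⟨e + 1, by ring⟩, a', b', ?_, ?_, h'⟩ <;> rw [this, h2] <;> ring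

theorem Fintype.sum_eq_zero_add_sum_units {F A : Type*} [Field F] [Fintype F] [AddCommMonoid A]
    (f : F → A) : ∑ x, f x = f 0 + ∑ x : Fˣ, f x := by
  rw [← Finset.add_sum_erase _ _ (Finset.mem_univ (0 : F))]
  congr 1
  symm
  refine Finset.sum_bij (fun x _ => (x : F)) ?_ ?_ ?_ ?_
  · simp
  · intro x _ y _ h
    exact Units.ext h
  · intro y hy
    exact ⟨Units.mk0 y (Finset.ne_of_mem_erase hy), Finset.mem_univ _, rfl⟩
  · simp

section TraceCount

variable (K : Type*) {F : Type*} [Field K] [Field F] [Fintype F] [Algebra K F]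

/-- The number of nonzero `x` with `Tr(βxᵈ) = 1`. -/
noncomputable def traceOneCount (d : ℕ) (β : F) : ℕ :=
  (Finset.univ.filter fun x : Fˣ => Algebra.trace K F (β * (x : F) ^ d) = 1).card

theorem traceOneCount_mul_pow (d : ℕ) (β : F) (u : Fˣ) :
    traceOneCount K d (β * (u : F) ^ d) = traceOneCount K d β := by
  refine Finset.card_equiv (Equiv.mulLeft u) fun x => ?_
  simp [mul_pow, mul_assoc]

theorem traceOneCount_zero (d : ℕ) : traceOneCount K d (0 : F) = 0 := by
  simp [traceOneCount]

theorem dvd_traceOneCount {d : ℕ} (hd : d ∣ Fintype.card F - 1) (β : F) :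
    d ∣ traceOneCount K d β := by
  obtain ⟨g, hg⟩ := IsCyclic.exists_generator (α := Fˣ)
  obtain ⟨e, he⟩ := hd
  rw [traceOneCount, Finset.card_filter,
    sum_eq_nsmul_sum_range_of_generator hg _ (d := e) (e := d)
      (by rw [Fintype.card_units, he])]
  · simp
  · intro i
    have : (g ^ e) ^ d = 1 := by
      rw [← pow_mul, mul_comm, ← he, ← Fintype.card_units, pow_card_eq_one]
    have h : ((g ^ (i + e) : Fˣ) : F) ^ d = ((g ^ i : Fˣ) : F) ^ d := by
      rw [← Units.val_pow_eq_pow_val, pow_add, mul_pow, this, mul_one, Units.val_pow_eq_pow_val]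
    rw [h]

variable {K} [Fintype K]

theorem card_trace_eq {d : ℕ} (hd : d ∣ (Fintype.card F - 1) / (Fintype.card K - 1)) (β : F)
    {c : K} (hc : c ≠ 0) :
    (Finset.univ.filter fun x : Fˣ => Algebra.trace K F (β * (x : F) ^ d) = c).card =
      traceOneCount K d β := by
  obtain ⟨u, hu⟩ := FiniteField.exists_units_pow_eq_algebraMap hd (inv_ne_zero hc)
  refine Finset.card_equiv (Equiv.mulLeft u) fun x => ?_
  have : β * ((u * x : Fˣ) : F) ^ d = c⁻¹ • (β * (x : F) ^ d) := by
    rw [Units.val_mul, mul_pow, hu, Algebra.smul_def]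
    ring
  simp only [Finset.mem_filter, Finset.mem_univ, true_and, Equiv.coe_mulLeft, this, map_smul,
    smul_eq_mul]
  rw [inv_mul_eq_one₀ hc, eq_comm]

theorem sum_comp_trace {d : ℕ} (hd : d ∣ (Fintype.card F - 1) / (Fintype.card K - 1)) (β : F)
    {A : Type*} [CommRing A] (f : K → A) :
    ∑ x : Fˣ, f (Algebra.trace K F (β * (x : F) ^ d)) =
      traceOneCount K d β * ∑ c, f c +
        (Fintype.card F - 1 - traceOneCount K d β * Fintype.card K) * f 0 := by
  set t : Fˣ → K := fun x => Algebra.trace K F (β * (x : F) ^ d) with ht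
  set n : A := ((Finset.univ.filter fun x : Fˣ => t x = 0).card : A) with hn
  have key : ∀ f : K → A, ∑ x : Fˣ, f (t x) =
      traceOneCount K d β * ∑ c, f c + (n - traceOneCount K d β) * f 0 := by
    intro f
    have hfib : ∑ x : Fˣ, f (t x) =
        ∑ c, ((Finset.univ.filter fun x : Fˣ => t x = c).card : A) * f c := by
      rw [← Finset.sum_fiberwise Finset.univ t]
      refine Finset.sum_congr rfl fun c _ => ?_
      rw [← nsmul_eq_mul, ← Finset.sum_const]
      refine Finset.sum_congr rfl fun x hx => ?_
      rw [(Finset.mem_filter.1 hx).2]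
    rw [hfib, ← Finset.add_sum_erase _ _ (Finset.mem_univ (0 : K)),
      ← Finset.add_sum_erase _ f (Finset.mem_univ (0 : K)), mul_add, Finset.mul_sum,
      Finset.sum_congr rfl fun c hc => by rw [card_trace_eq hd β (Finset.ne_of_mem_erase hc)]]
    ring
  have hone := key 1
  simp only [Pi.one_apply, Finset.sum_const, Finset.card_univ, nsmul_eq_mul, mul_one,
    Fintype.card_units, Nat.cast_sub Fintype.card_pos, Nat.cast_one] at hone
  rw [key f]
  linear_combination -f 0 * hone

theorem card_trace_ne_zero {d : ℕ} (hd : d ∣ (Fintype.card F - 1) / (Fintype.card K - 1))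
    (β : F) :
    ((Finset.univ.filter fun x : Fˣ => Algebra.trace K F (β * (x : F) ^ d) ≠ 0).card : ℤ) =
      (Fintype.card K - 1) * traceOneCount K d β := by
  rw [Finset.card_filter]
  push_cast
  have := sum_comp_trace hd β (fun c : K => if c ≠ 0 then (1 : ℤ) else 0)
  rw [this, ← Finset.add_sum_erase _ _ (Finset.mem_univ (0 : K)),
    Finset.sum_congr rfl fun c hc => if_pos (Finset.ne_of_mem_erase hc)]
  simp [Finset.card_erase_of_mem, Nat.cast_sub (Fintype.card_pos (α := K))]
  ring

/-- The value `|F| - |K| w` of the exponential sum of `βxᵈ`, where `w = traceOneCount K d β`. -/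
noncomputable def powerSum (K : Type*) {F : Type*} [Field K] [Fintype K] [Field F] [Fintype F]
    [Algebra K F] (d : ℕ) (β : F) : ℤ :=
  Fintype.card F - Fintype.card K * traceOneCount K d β

theorem sum_addChar_trace {d : ℕ} (hd0 : d ≠ 0)
    (hd : d ∣ (Fintype.card F - 1) / (Fintype.card K - 1))
    {χ : AddChar K ℂ} (hχ : χ ≠ 1) (β : F) :
    ∑ x : F, χ (Algebra.trace K F (β * x ^ d)) = powerSum K d β := by
  rw [Fintype.sum_eq_zero_add_sum_units, sum_comp_trace hd, AddChar.sum_eq_zero_of_ne_one hχ,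
    powerSum]
  simp [hd0]
  ring

theorem exists_isPrimitive_eq_trace (K F : Type*) [Field K] [Fintype K] [Field F] [Fintype F]
    [Algebra K F] :
    ∃ (χ : AddChar K ℂ) (ψ : AddChar F ℂ), χ ≠ 1 ∧ ψ.IsPrimitive ∧
      ∀ x, ψ x = χ (Algebra.trace K F x) := by
  have hχ := AddChar.FiniteField.primitiveChar_to_Complex_isPrimitive K
  set χ := AddChar.FiniteField.primitiveChar_to_Complex K
  have hχ1 : χ ≠ 1 := by
    have := hχ one_ne_zero
    rwa [AddChar.mulShift_one] at this
  refine ⟨χ, χ.compAddMonoidHom (Algebra.trace K F).toAddMonoidHom, hχ1,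
    AddChar.IsPrimitive.of_ne_one ?_, fun x => rfl⟩
  obtain ⟨c, hc⟩ := AddChar.ne_one_iff.1 hχ1
  obtain ⟨x, rfl⟩ := Algebra.trace_surjective K F c
  exact AddChar.ne_one_iff.2 ⟨x, hc⟩

theorem sum_powerSum {d : ℕ} (hd0 : d ≠ 0)
    (hd : d ∣ (Fintype.card F - 1) / (Fintype.card K - 1)) :
    ∑ β : Fˣ, powerSum K d (β : F) = 0 := by
  obtain ⟨χ, ψ, hχ, hψ, hχψ⟩ := exists_isPrimitive_eq_trace K F
  have h : ∑ β : F, (powerSum K d β : ℂ) = Fintype.card F := by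
    simp_rw [← sum_addChar_trace hd0 hd hχ, ← hχψ]
    rw [Finset.sum_comm]
    simp_rw [AddChar.sum_mulShift _ hψ]
    simp [hd0]
  rw [Fintype.sum_eq_zero_add_sum_units] at h
  have h0 : powerSum K d (0 : F) = Fintype.card F := by simp [powerSum, traceOneCount_zero]
  rw [h0] at h
  push_cast at h
  have h' : ∑ β : Fˣ, (powerSum K d (β : F) : ℂ) = 0 := by linear_combination h
  exact_mod_cast h'

theorem sum_ite_pow_add_pow_eq_zero {d : ℕ} (hd : Odd d) (hd' : d ∣ Fintype.card F - 1) :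
    ∑ x : F, ∑ y : F, (if x ^ d + y ^ d = 0 then (1 : ℕ) else 0) =
      1 + (Fintype.card F - 1) * d := by
  have hd0 : d ≠ 0 := hd.pos.ne'
  rw [Fintype.sum_eq_zero_add_sum_units]
  congr 1
  · simp [hd0]
  have key : ∀ x : Fˣ, ∑ y : F, (if (x : F) ^ d + y ^ d = 0 then (1 : ℕ) else 0) = d := by
    intro x
    rw [Fintype.sum_eq_zero_add_sum_units, ← Equiv.sum_comp (Equiv.mulLeft (-x))]
    have hiff : ∀ v : Fˣ, (x : F) ^ d + (((Equiv.mulLeft (-x)) v : Fˣ) : F) ^ d = 0 ↔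
        v ∈ (powMonoidHom d : Fˣ →* Fˣ).ker := by
      intro v
      rw [MonoidHom.mem_ker, powMonoidHom_apply, Equiv.coe_mulLeft, Units.val_mul,
        Units.val_neg, mul_pow, hd.neg_pow, Units.ext_iff, Units.val_pow_eq_pow_val, Units.val_one,
        neg_mul, ← sub_eq_add_neg, sub_eq_zero, eq_comm, mul_eq_left₀ (pow_ne_zero _ x.ne_zero)]
    simp_rw [hiff]
    rw [← Finset.card_filter, ← Fintype.card_subtype, ← Nat.card_eq_fintype_card]
    have := IsCyclic.card_powMonoidHom_ker (G := Fˣ) d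
    rw [Nat.card_eq_fintype_card (α := Fˣ), Fintype.card_units, Nat.gcd_eq_right hd'] at this
    rw [zero_pow hd0, add_zero, if_neg (pow_ne_zero _ x.ne_zero), zero_add]
    exact this
  rw [Finset.sum_congr rfl fun x _ => key x]
  simp [Fintype.card_units]

theorem sum_powerSum_sq {d : ℕ} (hd0 : Odd d)
    (hd : d ∣ (Fintype.card F - 1) / (Fintype.card K - 1)) (hd' : d ∣ Fintype.card F - 1) :
    ∑ β : Fˣ, powerSum K d (β : F) ^ 2 =
      (d - 1) * Fintype.card F * (Fintype.card F - 1) := by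
  obtain ⟨χ, ψ, hχ, hψ, hχψ⟩ := exists_isPrimitive_eq_trace K F
  have h : ∑ β : F, (powerSum K d β : ℂ) ^ 2 =
      Fintype.card F * ((1 + (Fintype.card F - 1) * d : ℕ) : ℂ) := by
    rw [← sum_ite_pow_add_pow_eq_zero hd0 hd']
    simp_rw [← sum_addChar_trace hd0.pos.ne' hd hχ, ← hχψ, sq, Finset.sum_mul_sum,
      ← AddChar.map_add_eq_mul, ← mul_add]
    rw [Finset.sum_comm]
    push_cast
    rw [Finset.mul_sum]
    refine Finset.sum_congr rfl fun x _ => ?_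
    rw [Finset.sum_comm, Finset.mul_sum]
    refine Finset.sum_congr rfl fun y _ => ?_
    rw [AddChar.sum_mulShift _ hψ]
    split_ifs <;> simp
  rw [Fintype.sum_eq_zero_add_sum_units] at h
  have h0 : powerSum K d (0 : F) = Fintype.card F := by simp [powerSum, traceOneCount_zero]
  rw [h0] at h
  push_cast [Nat.cast_sub (Fintype.card_pos (α := F))] at h
  have h' : ∑ β : Fˣ, (powerSum K d (β : F) : ℂ) ^ 2 =
      (d - 1) * Fintype.card F * (Fintype.card F - 1) := by linear_combination h
  exact_mod_cast h'

end TraceCount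

theorem mul_codewordWeight {K F : Type} [Field K] [Fintype K] [Field F] [Fintype F] [Algebra K F]
    {g : Fˣ} (hg : ∀ x, x ∈ Subgroup.zpowers g) {N : ℕ} (hN : N ∣ Fintype.card F - 1) (β : F) :
    N * codewordWeight K F ((g ^ N : Fˣ) : F) ((Fintype.card F - 1) / N) β =
      (Finset.univ.filter fun x : Fˣ => Algebra.trace K F (β * (x : F) ^
        Nat.gcd N ((Fintype.card F - 1) / (Fintype.card K - 1))) ≠ 0).card := by
  have hsum := FiniteField.sum_pow_eq_sum_pow_gcd (K := K) (F := F) N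
    (fun y => if Algebra.trace K F (β * y) ≠ 0 then 1 else 0) (fun a x ha => by
      rw [mul_left_comm, ← Algebra.smul_def, map_smul]
      simp [ha])
  rw [Finset.card_filter, ← hsum, sum_eq_nsmul_sum_range_of_generator hg _
    (d := (Fintype.card F - 1) / N) (e := N)
    (by rw [Fintype.card_units, Nat.mul_div_cancel' hN]), codewordWeight, Finset.card_filter,
    smul_eq_mul]
  · congr 1
    rw [← Fin.sum_univ_eq_sum_range]
    refine Finset.sum_congr rfl fun j _ => ?_
    simp_rw [← Units.val_pow_eq_pow_val, pow_right_comm]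
  · intro i
    have h1 : (g ^ ((Fintype.card F - 1) / N)) ^ N = 1 := by
      rw [← pow_mul, Nat.div_mul_cancel hN, ← Fintype.card_units, pow_card_eq_one]
    have h : ((g ^ (i + (Fintype.card F - 1) / N) : Fˣ) : F) ^ N = ((g ^ i : Fˣ) : F) ^ N := by
      rw [← Units.val_pow_eq_pow_val, pow_add, mul_pow, h1, mul_one, Units.val_pow_eq_pow_val]
    rw [h]

theorem mul_codewordWeight_eq {K F : Type} [Field K] [Fintype K] [Field F] [Fintype F]
    [Algebra K F] {g : Fˣ} (hg : ∀ x, x ∈ Subgroup.zpowers g) {N d : ℕ}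
    (hN : N ∣ Fintype.card F - 1)
    (hd : Nat.gcd N ((Fintype.card F - 1) / (Fintype.card K - 1)) = d) (β : F) :
    (N * Fintype.card K * codewordWeight K F ((g ^ N : Fˣ) : F) ((Fintype.card F - 1) / N) β : ℤ) =
      (Fintype.card K - 1) * (Fintype.card F - powerSum K d β) := by
  have h1 := mul_codewordWeight (K := K) hg hN β
  rw [hd] at h1
  have h2 := card_trace_ne_zero (hd ▸ Nat.gcd_dvd_right _ _) β
  rw [← h1] at h2
  push_cast at h2
  rw [powerSum]
  linear_combination (Fintype.card K : ℤ) * h2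

/-- Three integers congruent to `1` modulo `3`, with sum `0` and sum of squares `6 pᵏ`. -/
theorem cubic_period_values {p : ℕ} (hp : p.Prime) (hp3 : p % 3 = 2) (k : ℕ) {a b c : ℤ}
    (hsum : a + b + c = 0) (hsq : a ^ 2 + b ^ 2 + c ^ 2 = 6 * (p : ℤ) ^ k)
    (ha : a % 3 = 1) (hb : b % 3 = 1) :
    2 ∣ k ∧ ∃ e : ℤ, e = (-1) ^ (k / 2) * (p : ℤ) ^ (k / 2) ∧
      (a = -2 * e ∧ b = e ∧ c = e ∨ a = e ∧ b = -2 * e ∧ c = e ∨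
        a = e ∧ b = e ∧ c = -2 * e) := by
  obtain rfl : c = -a - b := by linear_combination hsum
  obtain ⟨hk, x, y, rfl, rfl, hxy⟩ := sq_add_mul_add_sq_eq_three_mul_pow hp hp3 k a b
    (by linarith)
  refine ⟨hk, _, rfl, ?_⟩
  set l := k / 2
  set s : ℤ := (-1) ^ l with hs
  have hs1 : s = 1 ∨ s = -1 := neg_one_pow_eq_or ℤ l
  have hT : (p : ℤ) ^ l % 3 = s % 3 := by
    have : (p : ℤ) ≡ -1 [ZMOD 3] := by
      unfold Int.ModEq
      omega
    exact this.pow l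
  set T : ℤ := (p : ℤ) ^ l
  have hx1 : -2 ≤ x := by nlinarith [sq_nonneg (x + 2 * y)]
  have hx2 : x ≤ 2 := by nlinarith [sq_nonneg (x + 2 * y)]
  have hy1 : -2 ≤ y := by nlinarith [sq_nonneg (2 * x + y)]
  have hy2 : y ≤ 2 := by nlinarith [sq_nonneg (2 * x + y)]
  rcases hs1 with h | h <;> rw [h] at hT ⊢ <;> clear_value s T <;> interval_cases x <;>
    interval_cases y <;> omega

theorem powerSum_three_emod_three {K F : Type*} [Field K] [Fintype K] [Field F] [Fintype F]
    [Algebra K F] (h : 3 ∣ Fintype.card F - 1) (β : F) : powerSum K 3 β % 3 = 1 := by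
  obtain ⟨v, hv⟩ := dvd_traceOneCount K h β
  obtain ⟨j, hj⟩ := h
  have hF : (Fintype.card F : ℤ) = 3 * j + 1 := by
    have := Fintype.card_pos (α := F)
    omega
  have : powerSum K 3 β = 1 + 3 * (j - Fintype.card K * v) := by
    rw [powerSum, hv, hF]
    push_cast
    ring
  rw [this]
  omega

/-- if `N₂ = 3` and `p ≡ 2 (mod 3)` then `k = sm` is even and
`C(r,N)` is a two-weight code: `(r-1)/3` nonzero codewords have weight
`(q-1)(r+(-1)^{k/2}·2√r)/(Nq)` and `2(r-1)/3` have weight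
`(q-1)(r-(-1)^{k/2}·√r)/(Nq)`. -/
theorem stmt18 (p s m N q r n k : ℕ) (hp : p.Prime) (hs : 0 < s) (hm : 0 < m)
    (hq : q = p ^ s) (hr : r = q ^ m) (hk : k = s * m)
    (hN : N ∣ r - 1) (hn : n = (r - 1) / N)
    (hN₂ : Nat.gcd N ((r - 1) / (q - 1)) = 3) (hp3 : p % 3 = 2)
    (K F : Type) [Field K] [Fintype K] [Field F] [Fintype F] [Algebra K F]
    (hcardK : Fintype.card K = q) (hcardF : Fintype.card F = r)
    (α : Fˣ) (hα : ∀ x : Fˣ, x ∈ Subgroup.zpowers α)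
    (hθ : ∀ x : F, x ∈ Algebra.adjoin K {((α ^ N : Fˣ) : F)}) :
    2 ∣ k ∧ ∃ t : ℕ, t ^ 2 = r ∧
      (Finset.univ.filter fun β : Fˣ =>
          ((N * q * codewordWeight K F ((α ^ N : Fˣ) : F) n (β : F) : ℕ) : ℤ) =
            ((q : ℤ) - 1) * ((r : ℤ) + (-1) ^ (k / 2) * 2 * (t : ℤ))).card =
        (r - 1) / 3 ∧
      (Finset.univ.filter fun β : Fˣ =>
          ((N * q * codewordWeight K F ((α ^ N : Fˣ) : F) n (β : F) : ℕ) : ℤ) =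
            ((q : ℤ) - 1) * ((r : ℤ) - (-1) ^ (k / 2) * (t : ℤ))).card =
        2 * (r - 1) / 3 := by
  subst hn hk
  subst hr
  subst hcardK
  have hrF : Fintype.card F = p ^ (s * m) := by rw [hcardF, hq, pow_mul]
  rw [← hcardF] at hN hN₂ ⊢
  clear hcardF
  have hF1 : 1 < Fintype.card F := Fintype.one_lt_card
  have hK1 : 1 < Fintype.card K := Fintype.one_lt_card
  have h3M : 3 ∣ (Fintype.card F - 1) / (Fintype.card K - 1) := hN₂ ▸ Nat.gcd_dvd_right _ _
  have h3F : 3 ∣ Fintype.card F - 1 := (hN₂ ▸ Nat.gcd_dvd_left _ _ : 3 ∣ N).trans hN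
  obtain ⟨e, he⟩ := h3F
  have hper : ∀ i : ℕ, powerSum K 3 ((α ^ (i + 3) : Fˣ) : F) =
      powerSum K 3 ((α ^ i : Fˣ) : F) := fun i => by
    rw [pow_add, Units.val_mul, Units.val_pow_eq_pow_val α 3, powerSum, traceOneCount_mul_pow,
      powerSum]
  have hclass : ∀ {A : Type} [AddCommMonoid A] (f : ℤ → A),
      ∑ β : Fˣ, f (powerSum K 3 (β : F)) = e • (f (powerSum K 3 (1 : F)) +
        f (powerSum K 3 (α : F)) + f (powerSum K 3 ((α ^ 2 : Fˣ) : F))) := fun f => by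
    rw [sum_eq_nsmul_sum_range_of_generator hα _ (d := 3) (e := e)
      (by rw [Fintype.card_units, he, mul_comm]) (fun i => by rw [hper])]
    simp [Finset.sum_range_succ]
  have he0 : (e : ℤ) ≠ 0 := by omega
  have hFe : (Fintype.card F : ℤ) = 3 * e + 1 := by omega
  have hsum := (hclass id).symm.trans (sum_powerSum three_ne_zero h3M)
  have hsq := (hclass (· ^ 2)).symm.trans
    (sum_powerSum_sq (by decide) h3M ⟨e, he⟩)
  have hmod := powerSum_three_emod_three (K := K) (F := F) ⟨e, he⟩
  obtain ⟨hk, E, hE, hvals⟩ := cubic_period_values hp hp3 (s * m)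
    (a := powerSum K 3 (1 : F)) (b := powerSum K 3 (α : F))
    (c := powerSum K 3 ((α ^ 2 : Fˣ) : F))
    (mul_left_cancel₀ he0 (by simpa using hsum))
    (mul_left_cancel₀ he0 (by
      rw [nsmul_eq_mul] at hsq
      have hFp : (Fintype.card F : ℤ) = (p : ℤ) ^ (s * m) := by exact_mod_cast hrF
      rw [hsq, ← hFp, hFe]
      push_cast
      ring)) (hmod _) (hmod _)
  refine ⟨hk, p ^ (s * m / 2), by rw [← pow_mul, Nat.div_mul_cancel hk, hrF], ?_⟩
  have hE0 : E ≠ 0 := by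
    rw [hE]
    exact mul_ne_zero (pow_ne_zero _ (by norm_num))
      (pow_ne_zero _ (by exact_mod_cast hp.ne_zero))
  have hiff : ∀ (β : F) (v : ℤ), ((N * Fintype.card K *
      codewordWeight K F ((α ^ N : Fˣ) : F) ((Fintype.card F - 1) / N) β : ℕ) : ℤ) =
        ((Fintype.card K : ℤ) - 1) * (Fintype.card F - v) ↔ powerSum K 3 β = v := by
    intro β v
    rw [Nat.cast_mul, Nat.cast_mul, mul_codewordWeight_eq hα hN hN₂, mul_right_inj' (by omega)]
    omega
  have h1 : (Fintype.card F : ℤ) + (-1) ^ (s * m / 2) * 2 * ((p ^ (s * m / 2) : ℕ) : ℤ) =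
      Fintype.card F - (-2 * E) := by
    rw [hE]; push_cast; ring
  have h2 : (Fintype.card F : ℤ) - (-1) ^ (s * m / 2) * ((p ^ (s * m / 2) : ℕ) : ℤ) =
      Fintype.card F - E := by
    rw [hE]; push_cast; ring
  have hne1 : -2 * E ≠ E := by omega
  have hne2 : E ≠ -2 * E := by omega
  simp_rw [h1, h2, hiff, Finset.card_filter,
    hclass (fun v => if v = -2 * E then 1 else 0), hclass (fun v => if v = E then 1 else 0)]
  rw [he]
  rcases hvals with ⟨ha, hb, hc⟩ | ⟨ha, hb, hc⟩ | ⟨ha, hb, hc⟩ <;> rw [ha, hb, hc] <;>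
    simp only [if_true, if_neg hne1, if_neg hne2, smul_eq_mul] <;> omega
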